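/- Let λ ∈ (0,1), let z > x_r, set γ = z − x_r, and let 0 < ε ≤ x_r − x_d. Suppose a > 0 satisfies P(ρ ≤ a) > 0 and E[ρ·1_{ρ≤a}] / P(ρ ≤ a) = ε/(γ + ε). Define α = x_r + ε·P̃(ρ > a)/P̃(ρ ≤ a) and X = (x_r − ε)·1_{ρ>a} + α·1_{ρ≤a}. Then X ≥ x_d almost surely, E[ρ·X] = x_r, E[X] = z, and CVaR_λ(X) ≤ −x_r + ε. (Hence the infimal CVaR value −x_r can be approached within ε by a two-line portfolio meeting both the capital constraint and the return constraint.) -/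

import Mathlib

open MeasureTheory

/-- Conditional Value-at-Risk at level `l` of a random variable `X` under `P`:
`CVaR_l(X) = (1/l) · inf_t ( E[(t − X)⁺] − l·t )`. -/
noncomputable def cvar {Ω : Type*} [MeasurableSpace Ω] (P : Measure Ω) (l : ℝ)
    (X : Ω → ℝ) : ℝ :=
  (1 / l) * ⨅ t : ℝ, ((∫ ω, max (t - X ω) 0 ∂P) - l * t)

/-- The objective of the variational formula for `cvar` is bounded below when `X` is bounded. -/
theorem bddBelow_cvar_objective {Ω : Type*} [MeasurableSpace Ω] {P : Measure Ω}
    [IsProbabilityMeasure P] {l c M : ℝ} (hl₀ : 0 ≤ l) (hl₁ : l ≤ 1) {X : Ω → ℝ}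
    (hXm : Measurable X) (hc : ∀ ω, c ≤ X ω) (hM : ∀ ω, X ω ≤ M) :
    BddBelow (Set.range fun t : ℝ => (∫ ω, max (t - X ω) 0 ∂P) - l * t) := by
  refine ⟨-(l * M), ?_⟩
  rintro _ ⟨t, rfl⟩
  have hint : Integrable (fun ω => max (t - X ω) 0) P := by
    refine Integrable.of_bound (by fun_prop) (max (t - c) 0) (.of_forall fun ω => ?_)
    rw [Real.norm_of_nonneg (le_max_right _ _)]
    exact max_le_max_right 0 (by linarith [hc ω])
  have hle : max (t - M) 0 ≤ ∫ ω, max (t - X ω) 0 ∂P := by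
    have := integral_mono (integrable_const (μ := P) (max (t - M) 0)) hint
      fun ω => max_le_max_right 0 (by linarith [hM ω])
    simpa using this
  have h₁ := (le_max_left (t - M) 0).trans hle
  have h₂ := (le_max_right (t - M) 0).trans hle
  dsimp only
  rcases le_total t M with h | h
  · nlinarith
  · nlinarith

/-- A bounded position that is at least `c` has Conditional Value-at-Risk at most `-c`. -/
theorem cvar_le_neg_of_le {Ω : Type*} [MeasurableSpace Ω] {P : Measure Ω}
    [IsProbabilityMeasure P] {l c M : ℝ} (hl₀ : 0 < l) (hl₁ : l ≤ 1) {X : Ω → ℝ}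
    (hXm : Measurable X) (hc : ∀ ω, c ≤ X ω) (hM : ∀ ω, X ω ≤ M) :
    cvar P l X ≤ -c := by
  have hinf := ciInf_le (bddBelow_cvar_objective (P := P) hl₀.le hl₁ hXm hc hM) c
  have hzero : ∀ ω, max (c - X ω) 0 = 0 := fun ω => max_eq_right (by linarith [hc ω])
  simp only [hzero, integral_zero, zero_sub] at hinf
  calc cvar P l X ≤ 1 / l * -(l * c) := mul_le_mul_of_nonneg_left hinf (by positivity)
    _ = -c := by field_simp

/-- Integral of `f` against a function taking the value `u` on `s` and `v` on its complement. -/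
theorem integral_mul_ite_const {Ω : Type*} [MeasurableSpace Ω] {P : Measure Ω} {f : Ω → ℝ}
    (hf : Integrable f P) {p : Ω → Prop} [DecidablePred p] (hp : MeasurableSet {ω | p ω})
    (u v : ℝ) :
    ∫ ω, f ω * (if p ω then u else v) ∂P =
      (∫ ω in {ω | p ω}, f ω ∂P) * u + (∫ ω in {ω | p ω}ᶜ, f ω ∂P) * v := by
  have hint : Integrable (fun ω => f ω * (if p ω then u else v)) P := by
    refine hf.mul_bdd (c := max |u| |v|)
      (Measurable.ite hp measurable_const measurable_const).aestronglyMeasurable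
      (.of_forall fun ω => ?_)
    split_ifs <;> simp
  rw [← integral_add_compl hp hint, ← integral_mul_const, ← integral_mul_const]
  congr 1
  · exact setIntegral_congr_fun hp fun ω hω => by
      have : p ω := hω
      simp [this]
  · exact setIntegral_congr_fun hp.compl fun ω hω => by
      have : ¬ p ω := hω
      simp [this]

/-- The infimal CVaR value `−x_r` can be approached within `ε` by a two-line portfolio
`X = (x_r − ε)·1_{ρ>a} + α·1_{ρ≤a}` meeting both the capital and return constraints. -/
theorem two_line_epsilon_suboptimal
    {Ω : Type*} [MeasurableSpace Ω] (P : Measure Ω) [IsProbabilityMeasure P]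
    (ρ : Ω → ℝ) (hρm : Measurable ρ) (hρpos : ∀ ω, 0 < ρ ω)
    (hρint : Integrable ρ P) (hρ1 : ∫ ω, ρ ω ∂P = 1)
    (x_d x_r : ℝ) (hdr : x_d < x_r)
    (lam : ℝ) (hlam : lam ∈ Set.Ioo (0 : ℝ) 1)
    (z γ ε a α : ℝ) (hz : x_r < z) (hγ : γ = z - x_r)
    (hε : 0 < ε) (hεle : ε ≤ x_r - x_d) (ha : 0 < a)
    (hPB : 0 < P {ω | ρ ω ≤ a})
    (hratio : (∫ ω in {ω | ρ ω ≤ a}, ρ ω ∂P) / (P {ω | ρ ω ≤ a}).toReal = ε / (γ + ε))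
    (hα : α = x_r + ε * (∫ ω in {ω | a < ρ ω}, ρ ω ∂P) / (∫ ω in {ω | ρ ω ≤ a}, ρ ω ∂P))
    (X : Ω → ℝ)
    (hX : X = fun ω => if a < ρ ω then x_r - ε else α) :
    (∀ᵐ ω ∂P, x_d ≤ X ω) ∧
    (∫ ω, ρ ω * X ω ∂P = x_r) ∧
    (∫ ω, X ω ∂P = z) ∧
    cvar P lam X ≤ -x_r + ε := by
  have hms : MeasurableSet {ω | a < ρ ω} := measurableSet_lt measurable_const hρm
  have hcompl : {ω | a < ρ ω}ᶜ = {ω | ρ ω ≤ a} := by ext; simp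
  have hp : 0 < (P {ω | ρ ω ≤ a}).toReal := ENNReal.toReal_pos hPB.ne' (measure_ne_top _ _)
  have hsum : (∫ ω in {ω | a < ρ ω}, ρ ω ∂P) + ∫ ω in {ω | ρ ω ≤ a}, ρ ω ∂P = 1 := by
    rw [← hcompl, integral_add_compl hms hρint, hρ1]
  have hmass : P.real {ω | a < ρ ω} + (P {ω | ρ ω ≤ a}).toReal = 1 := by
    rw [← hcompl]
    exact probReal_add_probReal_compl hms
  have hr : 0 ≤ ∫ ω in {ω | a < ρ ω}, ρ ω ∂P := integral_nonneg fun ω => (hρpos ω).le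
  have hcapital := integral_mul_ite_const hρint hms (x_r - ε) α
  have hreturn := integral_mul_ite_const (integrable_const (μ := P) (1 : ℝ)) hms (x_r - ε) α
  simp only [one_mul, setIntegral_const, smul_eq_mul, mul_one] at hreturn
  rw [hcompl] at hcapital hreturn
  rw [measureReal_def P {ω | ρ ω ≤ a}] at hreturn
  generalize (∫ ω in {ω | ρ ω ≤ a}, ρ ω ∂P) = q at *
  generalize (∫ ω in {ω | a < ρ ω}, ρ ω ∂P) = r at *
  generalize (P {ω | ρ ω ≤ a}).toReal = p at *
  have hγε : 0 < γ + ε := by linarith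
  have hq : 0 < q := by
    have : 0 < q / p := hratio ▸ div_pos hε hγε
    exact (div_pos_iff_of_pos_right hp).1 this
  have hαx : x_r ≤ α := by
    have : 0 ≤ ε * r / q := by positivity
    linarith
  have hαq : α * q = x_r * q + ε * r := by rw [hα]; field_simp
  have hpq : q * (γ + ε) = ε * p := (div_eq_div_iff hp.ne' hγε.ne').1 hratio
  have hXlow : ∀ ω, x_r - ε ≤ X ω := fun ω => by
    rw [hX]; dsimp only; split_ifs <;> linarith
  have hXup : ∀ ω, X ω ≤ α := fun ω => by
    rw [hX]; dsimp only; split_ifs <;> linarith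
  have hXm : Measurable X := hX ▸ Measurable.ite hms measurable_const measurable_const
  refine ⟨.of_forall fun ω => by linarith [hXlow ω], ?_, ?_, ?_⟩
  · simp only [hX]
    rw [hcapital]
    linear_combination hαq + x_r * hsum
  · simp only [hX]
    rw [hreturn]
    refine mul_left_cancel₀ hq.ne' ?_
    linear_combination q * (x_r - ε) * hmass + p * hαq + ε * p * hsum - hpq + q * hγ
  · exact (cvar_le_neg_of_le hlam.1 hlam.2.le hXm hXlow hXup).trans_eq (by ring)
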